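/- arXiv:2602.06472 — 8 statements merged into one kernel-verified Lean document; each statement's English description precedes it below -/
import Mathlib

section
/- For every natural number N ≥ 1 and every function m : Fin N → ℝ, with indices taken cyclically modulo N and mean m̄ = (1/N) ∑_{i=0}^{N-1} m_i, one has ∑_{i=0}^{N-1} (m_i − m_{i−1})² ≥ 4 sin²(π/N) · ∑_{i=0}^{N-1} (m_i − m̄)². -/
open Finset Real

open scoped ZMod in
lemma aux_parseval (N : ℕ) [NeZero N] (f : ZMod N → ℂ) :
    ∑ k, ‖ZMod.dft f k‖ ^ 2 = N * ∑ j, ‖f j‖ ^ 2 := by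
  have key : ∑ k, (starRingEnd ℂ) (ZMod.dft f k) * ZMod.dft f k
      = N * ∑ j, (starRingEnd ℂ) (f j) * f j := by
    calc ∑ k, (starRingEnd ℂ) (ZMod.dft f k) * ZMod.dft f k
        = ∑ k, ∑ j, (starRingEnd ℂ) (f j) * (ZMod.stdAddChar (j * k) * ZMod.dft f k) := by
          refine Finset.sum_congr rfl fun k _ => ?_
          conv_lhs => rw [ZMod.dft_apply f k]
          rw [map_sum, ← ZMod.dft_apply, Finset.sum_mul]
          refine Finset.sum_congr rfl fun j _ => ?_
          rw [smul_eq_mul, map_mul, ← AddChar.map_neg_eq_conj, neg_neg]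
          ring
      _ = ∑ j, (starRingEnd ℂ) (f j) * ∑ k, ZMod.stdAddChar (j * k) * ZMod.dft f k := by
          rw [Finset.sum_comm]
          simp_rw [Finset.mul_sum]
      _ = ∑ j, (starRingEnd ℂ) (f j) * ((N : ℂ) * f j) := by
          refine Finset.sum_congr rfl fun j _ => ?_
          congr 1
          have h := congrFun (ZMod.dft_dft f) (-j)
          rw [ZMod.dft_apply] at h
          simp only [neg_neg, smul_eq_mul] at h
          rw [← h]
          refine Finset.sum_congr rfl fun k _ => ?_
          congr 2
          ring
      _ = _ := by
          rw [Finset.mul_sum]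
          refine Finset.sum_congr rfl fun j _ => ?_
          ring
  simp_rw [Complex.conj_mul'] at key
  exact_mod_cast key

lemma aux_shift (N : ℕ) [NeZero N] (f : ZMod N → ℂ) (k : ZMod N) :
    ZMod.dft (fun j => f j - f (j - 1)) k = (1 - ZMod.stdAddChar (-k)) * ZMod.dft f k := by
  have h2 : ∑ j : ZMod N, ZMod.stdAddChar (-(j * k)) * f (j - 1)
      = ZMod.stdAddChar (-k) * ∑ j : ZMod N, ZMod.stdAddChar (-(j * k)) * f j := by
    rw [← Equiv.sum_comp (Equiv.addRight (1 : ZMod N)), Finset.mul_sum]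
    refine Finset.sum_congr rfl fun j _ => ?_
    simp only [Equiv.coe_addRight, add_sub_cancel_right]
    rw [← mul_assoc, ← AddChar.map_add_eq_mul]
    congr 2
    ring
  simp only [ZMod.dft_apply, smul_eq_mul, mul_sub, Finset.sum_sub_distrib, h2]
  ring

lemma aux_sin (N : ℕ) [NeZero N] (k : ZMod N) (hk : k ≠ 0) :
    4 * Real.sin (Real.pi / N) ^ 2 ≤ ‖1 - ZMod.stdAddChar k‖ ^ 2 := by
  have hN : (0 : ℝ) < N := by exact_mod_cast Nat.pos_of_ne_zero (NeZero.ne N)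
  have h1 : 1 ≤ k.val := Nat.one_le_iff_ne_zero.mpr (by rwa [Ne, ZMod.val_eq_zero])
  have h2 : k.val + 1 ≤ N := ZMod.val_lt k
  have h1' : (1 : ℝ) ≤ k.val := by exact_mod_cast h1
  have h2' : (k.val : ℝ) + 1 ≤ N := by exact_mod_cast h2
  have e : ZMod.stdAddChar k = Complex.exp (Complex.I * ((2 * π * k.val / N : ℝ) : ℂ)) := by
    rw [ZMod.stdAddChar_apply, ZMod.toCircle_apply]
    congr 1
    push_cast
    ring
  rw [norm_sub_rev, e, Complex.norm_exp_I_mul_ofReal_sub_one, Real.norm_eq_abs, sq_abs]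
  have e2 : 2 * π * k.val / N / 2 = π * k.val / N := by ring
  rw [e2]
  have hpos : 0 ≤ Real.sin (π / N) := by
    apply Real.sin_nonneg_of_nonneg_of_le_pi (by positivity)
    exact div_le_self pi_pos.le (by linarith)
  have hs : Real.sin (π / N) ≤ Real.sin (π * k.val / N) := by
    have a1 : π / N ≤ π * k.val / N := by
      gcongr; nlinarith [pi_pos]
    have a2 : π * k.val / N + π / N ≤ π := by
      rw [← add_div, div_le_iff₀ hN]; nlinarith [pi_pos]
    have hd : 0 < π / N := by positivity
    rcases le_total (π * k.val / N) (π / 2) with h | h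
    · exact Real.sin_le_sin_of_le_of_le_pi_div_two (by linarith [pi_pos]) h a1
    · rw [← Real.sin_pi_sub (π * k.val / N)]
      exact Real.sin_le_sin_of_le_of_le_pi_div_two (by linarith [pi_pos]) (by linarith)
        (by linarith)
  nlinarith

lemma aux_zmod (N : ℕ) [NeZero N] (m : ZMod N → ℝ) :
    4 * Real.sin (Real.pi / N) ^ 2 *
        ∑ i : ZMod N, (m i - (1 / (N : ℝ)) * ∑ j : ZMod N, m j) ^ 2 ≤
      ∑ i : ZMod N, (m i - m (i - 1)) ^ 2 := by
  have hN : (0 : ℝ) < N := by exact_mod_cast Nat.pos_of_ne_zero (NeZero.ne N)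
  set c : ℝ := (1 / (N : ℝ)) * ∑ j : ZMod N, m j with hc
  let f : ZMod N → ℂ := fun j => ((m j - c : ℝ) : ℂ)
  have h0 : ZMod.dft f 0 = 0 := by
    rw [ZMod.dft_apply_zero]
    have : ∑ j : ZMod N, (m j - c) = 0 := by
      rw [Finset.sum_sub_distrib, Finset.sum_const, Finset.card_univ, ZMod.card, nsmul_eq_mul, hc]
      field_simp
      ring
    simp only [f]
    exact_mod_cast this
  have p1 := aux_parseval N f
  have p2 := aux_parseval N (fun j => f j - f (j - 1))
  have q1 : ∑ j, ‖f j‖ ^ 2 = ∑ i : ZMod N, (m i - c) ^ 2 := by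
    refine Finset.sum_congr rfl fun j _ => ?_
    simp only [f]
    rw [Complex.norm_real, Real.norm_eq_abs, sq_abs]
  have q2 : ∑ j, ‖f j - f (j - 1)‖ ^ 2 = ∑ i : ZMod N, (m i - m (i - 1)) ^ 2 := by
    refine Finset.sum_congr rfl fun j _ => ?_
    simp only [f]
    rw [← Complex.ofReal_sub, Complex.norm_real, Real.norm_eq_abs, sq_abs]
    ring
  rw [q1] at p1
  rw [q2] at p2
  refine le_of_mul_le_mul_left ?_ hN
  rw [← p2, mul_left_comm, ← p1, Finset.mul_sum]
  refine Finset.sum_le_sum fun k _ => ?_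
  rw [aux_shift, norm_mul, mul_pow]
  by_cases hk : k = 0
  · rw [hk, h0]; simp
  · exact mul_le_mul_of_nonneg_right (aux_sin N (-k) (neg_ne_zero.mpr hk)) (by positivity)

/-- Cycle Laplacian quadratic-form inequality: for `m : Fin N → ℝ` with indices
taken cyclically modulo `N` and mean `m̄ = (1/N) ∑ i, m i`, one has
`∑ i, (m i - m (i-1))² ≥ 4 sin²(π/N) · ∑ i, (m i - m̄)²`. -/
theorem cycle_laplacian_lower_bound (N : ℕ) [NeZero N] (m : Fin N → ℝ) :
    4 * Real.sin (Real.pi / N) ^ 2 *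
        ∑ i : Fin N, (m i - (1 / (N : ℝ)) * ∑ j : Fin N, m j) ^ 2 ≤
      ∑ i : Fin N, (m i - m (i - 1)) ^ 2 := by
  obtain _ | n := N
  · exact absurd rfl (NeZero.ne 0)
  · exact aux_zmod (n + 1) m
end

section
/- Let N ≥ 1, κ > 0, let m : ℝ → (Fin N → ℝ) be differentiable and β : ℝ → (Fin N → ℝ), with indices taken cyclically modulo N, and suppose each component satisfies the workload dynamics m_i′(t) = κ [ β_{i+1}(t) (m_{i+1}(t) − m_i(t)) − β_i(t) (m_i(t) − m_{i−1}(t)) ] for all t. Then for every t: (a) the total workload ∑_{i} m_i(t) has derivative zero, and (b) the Lyapunov function V(t) = (1/2) ∑_i (m_i(t) − m̄(t))², where m̄(t) = (1/N) ∑_j m_j(t), has derivative V′(t) = −κ ∑_i β_i(t) (m_i(t) − m_{i−1}(t))²; in particular V′(t) ≤ 0 whenever β_i(t) ≥ 0 for all i. -/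
open Finset

/-- Core computation of Lemma 2: under the workload dynamics
`m_i′(t) = κ [β_{i+1}(t)(m_{i+1}(t) − m_i(t)) − β_i(t)(m_i(t) − m_{i−1}(t))]`
(indices cyclic modulo `N`), (a) the total workload has derivative zero, and
(b) the Lyapunov function `V(t) = (1/2) ∑ i, (m_i(t) − m̄(t))²` has derivative
`−κ ∑ i, β_i(t) (m_i(t) − m_{i−1}(t))²`, which is `≤ 0` when all `β_i(t) ≥ 0`. -/
theorem workload_dynamics_lyapunov_derivative (N : ℕ) [NeZero N] (κ : ℝ) (hκ : 0 < κ)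
    (m β : ℝ → Fin N → ℝ)
    (hdiff : ∀ i : Fin N, Differentiable ℝ (fun t => m t i))
    (hdyn : ∀ (i : Fin N) (t : ℝ),
      deriv (fun τ => m τ i) t =
        κ * (β t (i + 1) * (m t (i + 1) - m t i) - β t i * (m t i - m t (i - 1)))) :
    ∀ t : ℝ,
      HasDerivAt (fun τ => ∑ i : Fin N, m τ i) 0 t ∧
      HasDerivAt
        (fun τ => (1 / 2) * ∑ i : Fin N, (m τ i - (1 / (N : ℝ)) * ∑ j : Fin N, m τ j) ^ 2)
        (-κ * ∑ i : Fin N, β t i * (m t i - m t (i - 1)) ^ 2) t ∧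
      ((∀ i : Fin N, 0 ≤ β t i) →
        -κ * ∑ i : Fin N, β t i * (m t i - m t (i - 1)) ^ 2 ≤ 0) := by
  intro t
  have shift : ∀ f : Fin N → ℝ, ∑ i, f (i + 1) = ∑ i, f i := fun f =>
    Equiv.sum_comp (Equiv.addRight (1 : Fin N)) f
  have hd : ∀ i : Fin N, HasDerivAt (fun τ => m τ i)
      (κ * (β t (i + 1) * (m t (i + 1) - m t i) - β t i * (m t i - m t (i - 1)))) t := by
    intro i
    rw [← hdyn i t]
    exact (hdiff i t).hasDerivAt
  have key : ∀ c : ℝ, ∑ i : Fin N, (m t i - c) *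
      (κ * (β t (i + 1) * (m t (i + 1) - m t i) - β t i * (m t i - m t (i - 1)))) =
      -κ * ∑ i : Fin N, β t i * (m t i - m t (i - 1)) ^ 2 := by
    intro c
    have h := shift (fun i => κ * ((m t (i - 1) - c) * (β t i * (m t i - m t (i - 1)))))
    simp only [add_sub_cancel_right] at h
    rw [Finset.mul_sum, ← sub_eq_zero, ← Finset.sum_sub_distrib]
    rw [← sub_eq_zero, ← Finset.sum_sub_distrib] at h
    rw [← h]
    refine Finset.sum_congr rfl fun i _ => ?_
    ring
  have h1 : HasDerivAt (fun τ => ∑ i : Fin N, m τ i) 0 t := by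
    have h := HasDerivAt.fun_sum (u := Finset.univ) (fun i _ => hd i)
    refine h.congr_deriv ?_
    have k0 := key 0
    have k1 := key (-1)
    rw [← k0, ← sub_eq_zero, ← Finset.sum_sub_distrib] at k1
    rw [← k1]
    refine Finset.sum_congr rfl fun i _ => ?_
    ring
  refine ⟨h1, ?_, ?_⟩
  · have h := (HasDerivAt.fun_sum (u := Finset.univ) (fun i _ =>
      ((hd i).sub (h1.const_mul (1 / (N : ℝ)))).pow 2)).const_mul (1 / 2 : ℝ)
    refine h.congr_deriv ?_
    rw [← key ((1 / (N : ℝ)) * ∑ j : Fin N, m t j), Finset.mul_sum]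
    refine Finset.sum_congr rfl fun i _ => ?_
    simp only [Pi.sub_apply]
    push_cast
    ring
  · intro hb
    have : 0 ≤ κ * ∑ i : Fin N, β t i * (m t i - m t (i - 1)) ^ 2 :=
      mul_nonneg hκ.le (Finset.sum_nonneg fun i _ => mul_nonneg (hb i) (sq_nonneg _))
    linarith
end

section
/- Let N ≥ 1, κ > 0, ζ > 0, let m : ℝ → (Fin N → ℝ) be differentiable and β : ℝ → (Fin N → ℝ) with β_i(t) ≥ ζ for all i and t ≥ 0, with indices taken cyclically modulo N, and suppose m_i′(t) = κ [ β_{i+1}(t) (m_{i+1}(t) − m_i(t)) − β_i(t) (m_i(t) − m_{i−1}(t)) ] for all t ≥ 0. Then for all indices i, j and all t ≥ 0, |m_i(t) − m_j(t)| ≤ c₁ e^{−c₂ t}, where c₁ = 2 √(V(0)) with V(0) = (1/2) ∑_k (m_k(0) − m̄(0))², m̄(0) = (1/N) ∑_k m_k(0), and c₂ = 4 κ ζ sin²(π/N). -/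
open Finset Real

lemma zmod_parseval (N : ℕ) [NeZero N] (f : ZMod N → ℂ) :
    ∑ k : ZMod N, ‖∑ j : ZMod N, ZMod.stdAddChar (j * k) * f j‖ ^ 2 = N * ∑ j, ‖f j‖ ^ 2 := by
  have h1 (t : ZMod N) : ∑ i, (ZMod.stdAddChar (t * i) : ℂ) = if t = 0 then (N : ℂ) else 0 := by
    split_ifs with h
    · simp [h, ZMod.card]
    · exact AddChar.sum_eq_zero_of_ne_one (ZMod.isPrimitive_stdAddChar N h)
  have key : (∑ k : ZMod N, (∑ j : ZMod N, ZMod.stdAddChar (j * k) * f j) *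
      (starRingEnd ℂ) (∑ j : ZMod N, ZMod.stdAddChar (j * k) * f j)) =
      N * ∑ j, f j * (starRingEnd ℂ) (f j) := by
    have : ∀ k : ZMod N, (∑ j : ZMod N, ZMod.stdAddChar (j * k) * f j) *
      (starRingEnd ℂ) (∑ j : ZMod N, ZMod.stdAddChar (j * k) * f j) =
        ∑ j, ∑ l, (ZMod.stdAddChar ((j - l) * k) : ℂ) * (f j * (starRingEnd ℂ) (f l)) := by
      intro k
      rw [map_sum, Finset.sum_mul_sum]
      refine Finset.sum_congr rfl fun j _ => Finset.sum_congr rfl fun l _ => ?_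
      rw [map_mul (starRingEnd ℂ), ← AddChar.map_neg_eq_conj, sub_mul, sub_eq_add_neg, AddChar.map_add_eq_mul]
      ring
    simp_rw [this]
    rw [Finset.sum_comm, Finset.mul_sum]
    refine Finset.sum_congr rfl fun j _ => ?_
    rw [Finset.sum_comm]
    simp_rw [← Finset.sum_mul, h1, sub_eq_zero]
    simp
  simp_rw [Complex.mul_conj, Complex.normSq_eq_norm_sq] at key
  exact_mod_cast key

lemma norm_char_sub (N : ℕ) [NeZero N] (k : ZMod N) (hk : k ≠ 0) :
    4 * sin (π / N) ^ 2 ≤ ‖(ZMod.stdAddChar (-k) : ℂ) - 1‖ ^ 2 := by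
  have hN : (0:ℝ) < N := by exact_mod_cast Nat.pos_of_ne_zero (NeZero.ne N)
  have h0 : 1 ≤ k.val := Nat.one_le_iff_ne_zero.2 (by simpa using hk)
  have h1 : k.val + 1 ≤ N := ZMod.val_lt k
  have h0' : (1:ℝ) ≤ k.val := by exact_mod_cast h0
  have h1' : (k.val:ℝ) + 1 ≤ N := by exact_mod_cast h1
  have e : ‖(ZMod.stdAddChar (-k) : ℂ) - 1‖ ^ 2 = 4 * sin (π * k.val / N) ^ 2 := by
    have : ‖(ZMod.stdAddChar (-k) : ℂ) - 1‖ = ‖(ZMod.stdAddChar k : ℂ) - 1‖ := by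
      rw [AddChar.map_neg_eq_conj, ← Complex.norm_conj]; simp
    rw [this, ZMod.stdAddChar_apply, ZMod.toCircle_apply]
    have : (2 * π * Complex.I * k.val / N : ℂ) = Complex.I * ((2 * π * k.val / N : ℝ) : ℂ) := by
      push_cast; ring
    rw [this, Complex.norm_exp_I_mul_ofReal_sub_one]
    rw [show 2 * π * k.val / N / 2 = π * k.val / N by ring]
    rw [Real.norm_eq_abs, sq_abs]; ring
  rw [e]
  have hp : 0 < sin (π / N) ∨ sin (π/N) = 0 := by
    refine (lt_or_eq_of_le (sin_nonneg_of_nonneg_of_le_pi (by positivity) ?_)).imp id Eq.symm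
    rw [div_le_iff₀ hN]; nlinarith [pi_pos]
  have : sin (π / N) ≤ sin (π * k.val / N) := by
    rcases le_total (2 * (k.val : ℝ)) N with h | h
    · apply sin_le_sin_of_le_of_le_pi_div_two
      · have : 0 ≤ π / N := by positivity
        linarith [pi_pos]
      · rw [div_le_iff₀ hN]; nlinarith [pi_pos]
      · gcongr; nlinarith [pi_pos]
    · rw [← sin_pi_sub (π * k.val / N)]
      apply sin_le_sin_of_le_of_le_pi_div_two
      · have : 0 ≤ π / N := by positivity
        linarith [pi_pos]
      · have : π / 2 ≤ π * k.val / N := by rw [le_div_iff₀ hN]; nlinarith [pi_pos]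
        linarith
      · have : π - π * k.val / N = π * (N - k.val) / N := by field_simp
        rw [this]; gcongr; nlinarith [pi_pos]
  have : 0 ≤ sin (π / N) := by rcases hp with h | h <;> linarith
  gcongr

lemma zmod_wirtinger (N : ℕ) [NeZero N] (x : ZMod N → ℝ) (hx : ∑ i, x i = 0) :
    4 * sin (π / N) ^ 2 * ∑ i, x i ^ 2 ≤ ∑ i, (x (i + 1) - x i) ^ 2 := by
  have hN : (0:ℝ) < N := by exact_mod_cast Nat.pos_of_ne_zero (NeZero.ne N)
  have p1 := zmod_parseval N (fun j => (x j : ℂ))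
  have p2 := zmod_parseval N (fun j => ((x (j + 1) - x j : ℝ) : ℂ))
  simp only [Complex.norm_real, Real.norm_eq_abs, sq_abs] at p1 p2
  refine le_of_mul_le_mul_left ?_ hN
  rw [← p2, mul_left_comm, ← p1, Finset.mul_sum]
  refine Finset.sum_le_sum fun k _ => ?_
  have hs : ∑ j : ZMod N, (ZMod.stdAddChar (j * k) : ℂ) * ((x (j + 1) - x j : ℝ) : ℂ) =
      (ZMod.stdAddChar (-k) - 1) * ∑ j : ZMod N, (ZMod.stdAddChar (j * k) : ℂ) * (x j : ℂ) := by
    have := Equiv.sum_comp (Equiv.addRight (1 : ZMod N))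
      (fun j => (ZMod.stdAddChar (-k) : ℂ) * ((ZMod.stdAddChar (j * k) : ℂ) * (x j : ℂ)))
    rw [sub_mul, Finset.mul_sum, ← this, one_mul, ← Finset.sum_sub_distrib]
    refine Finset.sum_congr rfl fun j _ => ?_
    simp only [Equiv.coe_addRight]
    rw [← mul_assoc, ← AddChar.map_add_eq_mul]
    rw [show -k + (j + 1) * k = j * k by ring]
    push_cast; ring
  rw [hs, norm_mul, mul_pow]
  by_cases hk : k = 0
  · subst hk
    have : (∑ j, (x j : ℂ)) = 0 := by exact_mod_cast hx
    simp [this]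
  · exact mul_le_mul_of_nonneg_right (norm_char_sub N k hk) (by positivity)

lemma fin_wirtinger (N : ℕ) [NeZero N] (x : Fin N → ℝ) (hx : ∑ i, x i = 0) :
    4 * sin (π / N) ^ 2 * ∑ i, x i ^ 2 ≤ ∑ i, (x (i + 1) - x i) ^ 2 := by
  cases N with
  | zero => exact absurd rfl (NeZero.ne 0)
  | succ n => exact zmod_wirtinger (n + 1) x hx

theorem workload_pairwise_exponential_bound (N : ℕ) [NeZero N] (κ ζ : ℝ)
    (hκ : 0 < κ) (hζ : 0 < ζ)
    (m β : ℝ → Fin N → ℝ)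
    (hdiff : ∀ i : Fin N, Differentiable ℝ (fun t => m t i))
    (hβ : ∀ (i : Fin N) (t : ℝ), 0 ≤ t → ζ ≤ β t i)
    (hdyn : ∀ (i : Fin N) (t : ℝ), 0 ≤ t →
      deriv (fun τ => m τ i) t =
        κ * (β t (i + 1) * (m t (i + 1) - m t i) - β t i * (m t i - m t (i - 1)))) :
    ∀ (i j : Fin N) (t : ℝ), 0 ≤ t →
      |m t i - m t j| ≤
        (2 * Real.sqrt
            ((1 / 2) * ∑ k : Fin N, (m 0 k - (1 / (N : ℝ)) * ∑ l : Fin N, m 0 l) ^ 2)) *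
          Real.exp (-(4 * κ * ζ * Real.sin (Real.pi / N) ^ 2) * t) := by
  intro i j t ht
  have hN : (0:ℝ) < N := by exact_mod_cast Nat.pos_of_ne_zero (NeZero.ne N)
  set a : ℝ := (1 / (N : ℝ)) * ∑ l : Fin N, m 0 l with ha
  set c : ℝ := 4 * κ * ζ * Real.sin (Real.pi / N) ^ 2 with hc
  -- derivative
  have hd : ∀ (i : Fin N) (t : ℝ), 0 ≤ t → HasDerivAt (fun τ => m τ i)
      (κ * (β t (i + 1) * (m t (i + 1) - m t i) - β t i * (m t i - m t (i - 1)))) t := by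
    intro i t ht
    rw [← hdyn i t ht]
    exact (hdiff i t).hasDerivAt
  have shift : ∀ g : Fin N → ℝ, ∑ i, g (i + 1) = ∑ i, g i := fun g => by
    cases N with
    | zero => exact absurd rfl (NeZero.ne 0)
    | succ n => exact Equiv.sum_comp (Equiv.addRight (1 : Fin (n+1))) g
  have cancel : ∀ i : Fin N, i + 1 - 1 = i := fun i => by
    cases N with
    | zero => exact absurd rfl (NeZero.ne 0)
    | succ n => exact add_sub_cancel_right i 1
  -- conservation of the sum
  have hsum : ∀ t, 0 ≤ t → ∑ k, (m t k - a) = 0 := by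
    have hS : ∀ t, 0 ≤ t → HasDerivAt (fun τ => ∑ k, m τ k) 0 t := by
      intro t ht
      have h := HasDerivAt.fun_sum (u := Finset.univ) fun k _ => hd k t ht
      refine h.congr_deriv ?_
      rw [← Finset.mul_sum, Finset.sum_sub_distrib]
      have := shift (fun i => β t i * (m t i - m t (i - 1)))
      simp only [cancel] at this
      rw [this]; ring
    intro t ht
    have : ∑ k, m t k = ∑ k, m 0 k := by
      refine (convex_Ici (0:ℝ)).is_const_of_fderivWithin_eq_zero (𝕜 := ℝ)
        (f := fun τ => ∑ k, m τ k) ?_ ?_ ht (Set.mem_Ici.2 le_rfl)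
      · intro s hs
        exact (hS s hs).differentiableAt.differentiableWithinAt
      · intro s hs
        have h := (hS s hs).hasFDerivAt.hasFDerivWithinAt.fderivWithin
          (uniqueDiffOn_Ici (0:ℝ) s hs)
        rw [h]; ext; simp
    rw [Finset.sum_sub_distrib, this]
    simp [ha]
    field_simp
    ring
  -- Lyapunov decay
  set W : ℝ → ℝ := fun t => ∑ k, (m t k - a) ^ 2 with hW
  have hWd : ∀ t, 0 ≤ t → HasDerivAt W
      (-(2 * κ) * ∑ k, β t (k + 1) * (m t (k + 1) - m t k) ^ 2) t := by
    intro t ht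
    have h := HasDerivAt.fun_sum (u := Finset.univ)
      fun k _ => ((hd k t ht).sub_const a).fun_pow 2
    refine h.congr_deriv ?_
    have e := shift (fun i => (m t i - a) * (β t i * (m t i - m t (i - 1))))
    simp only [cancel] at e
    have : ∀ k, ((2:ℕ):ℝ) * (m t k - a) ^ (2 - 1) *
        (κ * (β t (k + 1) * (m t (k + 1) - m t k) - β t k * (m t k - m t (k - 1)))) =
        2 * κ * ((m t k - a) * (β t (k + 1) * (m t (k + 1) - m t k)) -
          (m t k - a) * (β t k * (m t k - m t (k - 1)))) := by
      intro k; norm_num; ring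
    simp_rw [this]
    rw [← Finset.mul_sum, Finset.sum_sub_distrib, ← e, ← Finset.sum_sub_distrib, neg_mul,
      ← mul_neg, ← Finset.sum_neg_distrib]
    congr 1
    refine Finset.sum_congr rfl fun k _ => ?_
    ring
  have hWle : ∀ t, 0 ≤ t →
      -(2 * κ) * ∑ k, β t (k + 1) * (m t (k + 1) - m t k) ^ 2 ≤ -(2 * c) * W t := by
    intro t ht
    have w := fin_wirtinger N (fun k => m t k - a) (hsum t ht)
    simp only [sub_sub_sub_cancel_right] at w
    have b : ζ * ∑ k, (m t (k + 1) - m t k) ^ 2 ≤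
        ∑ k, β t (k + 1) * (m t (k + 1) - m t k) ^ 2 := by
      rw [Finset.mul_sum]
      exact Finset.sum_le_sum fun k _ =>
        mul_le_mul_of_nonneg_right (hβ _ t ht) (sq_nonneg _)
    have := mul_le_mul_of_nonneg_left ((mul_le_mul_of_nonneg_left w hζ.le).trans b) hκ.le
    simp only [hc, hW]
    linarith
  have hanti : AntitoneOn (fun t => W t * exp (2 * c * t)) (Set.Ici 0) := by
    have hder : ∀ t, 0 ≤ t → HasDerivAt (fun t => W t * exp (2 * c * t))
        ((-(2 * κ) * ∑ k, β t (k + 1) * (m t (k + 1) - m t k) ^ 2) * exp (2 * c * t) +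
          W t * (exp (2 * c * t) * (2 * c * 1))) t := fun t ht =>
      (hWd t ht).mul (((hasDerivAt_id t).const_mul (2 * c)).exp)
    refine antitoneOn_of_deriv_nonpos (convex_Ici 0)
      (fun s hs => (hder s hs).continuousAt.continuousWithinAt) ?_ ?_
    · intro s hs
      rw [interior_Ici] at hs
      exact (hder s (le_of_lt hs)).differentiableAt.differentiableWithinAt
    · intro s hs
      rw [interior_Ici] at hs
      rw [(hder s (le_of_lt hs)).deriv]
      nlinarith [mul_le_mul_of_nonneg_right (hWle s (le_of_lt hs)) (exp_pos (2 * c * s)).le]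
  have hfin : W t * exp (2 * c * t) ≤ W 0 := by
    simpa using hanti (Set.mem_Ici.2 le_rfl) (Set.mem_Ici.2 ht) ht
  have hWt : W t ≤ W 0 * exp (-c * t) ^ 2 := by
    have e1 : exp (2 * c * t) * exp (-c * t) ^ 2 = 1 := by
      rw [← exp_nat_mul, ← exp_add, exp_eq_one_iff]; push_cast; ring
    calc W t = (W t * exp (2 * c * t)) * exp (-c * t) ^ 2 := by rw [mul_assoc, e1, mul_one]
      _ ≤ _ := mul_le_mul_of_nonneg_right hfin (sq_nonneg _)
  have hij : (m t i - m t j) ^ 2 ≤ 2 * W t := by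
    by_cases h : i = j
    · subst h
      have : 0 ≤ W t := Finset.sum_nonneg fun _ _ => sq_nonneg _
      rw [sub_self]; linarith
    · have : (m t i - a) ^ 2 + (m t j - a) ^ 2 ≤ W t := by
        rw [← Finset.sum_pair (f := fun k => (m t k - a) ^ 2) h]
        exact Finset.sum_le_sum_of_subset_of_nonneg (Finset.subset_univ _)
          fun _ _ _ => sq_nonneg _
      nlinarith [sq_nonneg ((m t i - a) + (m t j - a))]
  refine abs_le_of_sq_le_sq ?_ (by positivity)
  have hW0 : 0 ≤ W 0 := by simp only [hW]; positivity
  change _ ≤ (2 * √(1 / 2 * W 0) * exp (-c * t)) ^ 2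
  rw [mul_pow, mul_pow, sq_sqrt (by positivity)]
  linarith
end

section
/- Let N ≥ 1, κ > 0, ζ > 0, let m : ℝ → (Fin N → ℝ) be differentiable and β : ℝ → (Fin N → ℝ) with β_i(t) ≥ ζ for all i and t ≥ 0, with indices taken cyclically modulo N, and suppose m_i′(t) = κ [ β_{i+1}(t) (m_{i+1}(t) − m_i(t)) − β_i(t) (m_i(t) − m_{i−1}(t)) ] for all t ≥ 0. Then the workloads equalize: for all indices i, j, the difference m_i(t) − m_j(t) tends to 0 as t → ∞. -/
open Finset Filter

lemma wl_shift {N : ℕ} [NeZero N] (g : Fin N → ℝ) : ∑ i, g (i + 1) = ∑ i, g i :=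
  Equiv.sum_comp (Equiv.addRight (1 : Fin N)) g

lemma wl_poincare {N : ℕ} [NeZero N] (x : Fin N → ℝ) (i j : Fin N) :
    (x i - x j) ^ 2 ≤ 4 * (N : ℝ) ^ 2 * ∑ k, (x k - x (k - 1)) ^ 2 := by
  set D := ∑ k, (x k - x (k - 1)) ^ 2 with hD
  have hD0 : 0 ≤ D := Finset.sum_nonneg fun k _ => sq_nonneg _
  have step : ∀ k, |x k - x (k - 1)| ≤ √D := fun k => by
    apply Real.abs_le_sqrt
    exact Finset.single_le_sum (f := fun k => (x k - x (k - 1)) ^ 2)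
      (fun k _ => sq_nonneg _) (Finset.mem_univ k)
  have key : ∀ (k : ℕ) (h : k < N), |x ⟨k, h⟩ - x 0| ≤ k * √D := by
    intro k
    induction k with
    | zero =>
      intro h
      have : (⟨0, h⟩ : Fin N) = 0 := by ext; simp
      simp [this]
    | succ k ih =>
      intro h
      have h1 := ih (by omega)
      have h2 := step ⟨k + 1, h⟩
      have e : (⟨k + 1, h⟩ : Fin N) - 1 = ⟨k, by omega⟩ := by
        rw [sub_eq_iff_eq_add]
        ext
        rw [Fin.val_add]
        have : ((1 : Fin N) : ℕ) = 1 % N := rfl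
        simp only [this]
        rw [Nat.mod_eq_of_lt (show 1 < N by omega), Nat.mod_eq_of_lt h]
      rw [e] at h2
      have := abs_sub_le (x ⟨k + 1, h⟩) (x ⟨k, by omega⟩) (x 0)
      push_cast
      linarith
  have key' : ∀ k : Fin N, |x k - x 0| ≤ N * √D := fun k => by
    refine (key k.1 k.2).trans ?_
    have : ((k : ℕ) : ℝ) ≤ N := by exact_mod_cast k.2.le
    gcongr
  have h : |x i - x j| ≤ 2 * N * √D := by
    have h1 := key' i
    have h2 := key' j
    have := abs_sub_le (x i) (x 0) (x j)
    rw [abs_sub_comm (x 0)] at this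
    linarith
  have h3 : (x i - x j) ^ 2 ≤ (2 * N * √D) ^ 2 := by
    rw [← sq_abs]
    gcongr
  calc _ ≤ _ := h3
    _ = 4 * (N : ℝ) ^ 2 * (√D) ^ 2 := by ring
    _ = _ := by rw [Real.sq_sqrt hD0]

lemma wl_energy {N : ℕ} [NeZero N] (x b : Fin N → ℝ) (κ : ℝ) (v : Fin N → ℝ)
    (hv : ∀ i, v i = κ * (b (i + 1) * (x (i + 1) - x i) - b i * (x i - x (i - 1)))) :
    ∑ i, ∑ j, 2 * (x i - x j) * (v i - v j)
      = -(4 * N * κ) * ∑ i, b i * (x i - x (i - 1)) ^ 2 := by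
  have hS : ∑ i, v i = 0 := by
    have := wl_shift (fun i => b i * (x i - x (i - 1)))
    simp only [add_sub_cancel_right] at this
    simp only [hv, ← Finset.mul_sum, Finset.sum_sub_distrib, this, sub_self, mul_zero]
  have hE : ∑ i, x i * v i = -κ * ∑ i, b i * (x i - x (i - 1)) ^ 2 := by
    have := wl_shift (fun i => x (i - 1) * (b i * (x i - x (i - 1))))
    simp only [add_sub_cancel_right] at this
    calc ∑ i, x i * v i = κ * (∑ i, x i * (b (i + 1) * (x (i + 1) - x i))
          - ∑ i, x i * (b i * (x i - x (i - 1)))) := by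
          rw [← Finset.sum_sub_distrib, Finset.mul_sum]
          exact Finset.sum_congr rfl fun i _ => by rw [hv]; ring
      _ = _ := by
          rw [this, ← Finset.sum_sub_distrib, Finset.mul_sum, Finset.mul_sum]
          exact Finset.sum_congr rfl fun i _ => by ring
  have h1 : ∀ i, ∑ j, 2 * (x i - x j) * (v i - v j)
      = 2 * N * (x i * v i) - 2 * x i * ∑ j, v j - 2 * v i * ∑ j, x j
        + 2 * ∑ j, x j * v j := by
    intro i
    have : (2 * N * (x i * v i) : ℝ) = ∑ j : Fin N, 2 * (x i * v i) := by
      simp; ring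
    rw [this, Finset.mul_sum, Finset.mul_sum, Finset.mul_sum, ← Finset.sum_sub_distrib,
      ← Finset.sum_sub_distrib, ← Finset.sum_add_distrib]
    exact Finset.sum_congr rfl fun j _ => by ring
  simp only [h1, hS, Finset.sum_add_distrib, Finset.sum_sub_distrib, ← Finset.mul_sum,
    ← Finset.sum_mul, hE, mul_zero, Finset.sum_const, Finset.card_univ, Fintype.card_fin,
    nsmul_eq_mul]
  ring

/-- Workload equalization (Lemma 2): under the workload dynamics with boundary
fluxes `β_i(t) ≥ ζ > 0` (indices cyclic modulo `N`), for all indices `i, j`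
the difference `m_i(t) − m_j(t)` tends to `0` as `t → ∞`. -/
theorem workload_equalization (N : ℕ) [NeZero N] (κ ζ : ℝ) (hκ : 0 < κ) (hζ : 0 < ζ)
    (m β : ℝ → Fin N → ℝ)
    (hdiff : ∀ i : Fin N, Differentiable ℝ (fun t => m t i))
    (hβ : ∀ (i : Fin N) (t : ℝ), 0 ≤ t → ζ ≤ β t i)
    (hdyn : ∀ (i : Fin N) (t : ℝ), 0 ≤ t →
      deriv (fun τ => m τ i) t =
        κ * (β t (i + 1) * (m t (i + 1) - m t i) - β t i * (m t i - m t (i - 1)))) :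
    ∀ i j : Fin N, Tendsto (fun t => m t i - m t j) atTop (nhds 0) := by
  have hN : (0 : ℝ) < N := by exact_mod_cast Nat.pos_of_ne_zero (NeZero.ne N)
  set W : ℝ → ℝ := fun t => ∑ i, ∑ j, (m t i - m t j) ^ 2 with hW
  have hWd : ∀ t, HasDerivAt W (∑ i, ∑ j, 2 * (m t i - m t j) *
      (deriv (fun τ => m τ i) t - deriv (fun τ => m τ j) t)) t := by
    intro t
    apply HasDerivAt.fun_sum
    intro i _
    apply HasDerivAt.fun_sum
    intro j _
    have := (((hdiff i) t).hasDerivAt.fun_sub ((hdiff j) t).hasDerivAt).fun_pow 2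
    simpa using this
  obtain ⟨l, hl⟩ : ∃ l : ℝ, l = κ * ζ / (N : ℝ) ^ 3 := ⟨_, rfl⟩
  have hl0 : 0 < l := by rw [hl]; positivity
  have hle : ∀ t, 0 ≤ t → deriv W t ≤ -l * W t := by
    intro t ht
    rw [(hWd t).deriv, wl_energy (m t) (β t) κ _ (fun i => hdyn i t ht)]
    have hA : ζ * ∑ i, (m t i - m t (i - 1)) ^ 2 ≤ ∑ i, β t i * (m t i - m t (i - 1)) ^ 2 := by
      rw [Finset.mul_sum]
      exact Finset.sum_le_sum fun i _ => mul_le_mul_of_nonneg_right (hβ i t ht) (sq_nonneg _)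
    have hB : W t ≤ N * (N * (4 * (N : ℝ) ^ 2 * ∑ i, (m t i - m t (i - 1)) ^ 2)) := by
      have : ∀ i, ∑ j, (m t i - m t j) ^ 2
          ≤ N * (4 * (N : ℝ) ^ 2 * ∑ i, (m t i - m t (i - 1)) ^ 2) := fun i => by
        refine (Finset.sum_le_sum fun j _ => wl_poincare (m t) i j).trans ?_
        simp
      refine (Finset.sum_le_sum fun i _ => this i).trans ?_
      simp
    have hC := mul_le_mul_of_nonneg_left hB hl0.le
    have hD := mul_le_mul_of_nonneg_left hA (show 0 ≤ 4 * N * κ by positivity)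
    have hE : l * (N * (N * (4 * (N : ℝ) ^ 2 * ∑ i, (m t i - m t (i - 1)) ^ 2)))
        = 4 * N * κ * (ζ * ∑ i, (m t i - m t (i - 1)) ^ 2) := by
      rw [hl]; field_simp
    linarith
  have hanti : AntitoneOn (fun t => W t * Real.exp (l * t)) (Set.Ici 0) := by
    have hd : ∀ t, HasDerivAt (fun t => W t * Real.exp (l * t))
        (deriv W t * Real.exp (l * t) + W t * (Real.exp (l * t) * l)) t := by
      intro t
      have h2 : HasDerivAt (fun t => Real.exp (l * t)) (Real.exp (l * t) * l) t := by
        simpa using ((hasDerivAt_id t).const_mul l).exp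
      exact ((hWd t).differentiableAt.hasDerivAt).mul h2
    apply antitoneOn_of_deriv_nonpos (convex_Ici 0)
    · exact fun t _ => (hd t).continuousAt.continuousWithinAt
    · exact fun t _ => (hd t).differentiableAt.differentiableWithinAt
    · intro t ht
      rw [interior_Ici] at ht
      rw [(hd t).deriv]
      have := mul_le_mul_of_nonneg_right (hle t (le_of_lt ht)) (Real.exp_pos (l * t)).le
      linarith
  have hbd : ∀ t, 0 ≤ t → W t ≤ W 0 * Real.exp (-(l * t)) := by
    intro t ht
    have := hanti (Set.mem_Ici.2 le_rfl) (Set.mem_Ici.2 ht) ht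
    simp only [mul_zero, Real.exp_zero, mul_one] at this
    rw [Real.exp_neg, ← div_eq_mul_inv, le_div_iff₀ (Real.exp_pos _)]
    exact this
  have hlim : Tendsto (fun t => W 0 * Real.exp (-(l * t))) atTop (nhds 0) := by
    have h1 : Tendsto (fun t : ℝ => l * t) atTop atTop := tendsto_id.const_mul_atTop hl0
    simpa using (Real.tendsto_exp_neg_atTop_nhds_zero.comp h1).const_mul (W 0)
  intro i j
  have hsq : Tendsto (fun t => (m t i - m t j) ^ 2) atTop (nhds 0) := by
    refine tendsto_of_tendsto_of_tendsto_of_le_of_le' tendsto_const_nhds hlim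
      (Eventually.of_forall fun t => sq_nonneg _) ?_
    filter_upwards [eventually_ge_atTop 0] with t ht
    refine le_trans ?_ (hbd t ht)
    refine le_trans ?_ (Finset.single_le_sum (f := fun i => ∑ j, (m t i - m t j) ^ 2)
      (fun i _ => Finset.sum_nonneg fun j _ => sq_nonneg _) (Finset.mem_univ i))
    exact Finset.single_le_sum (f := fun j => (m t i - m t j) ^ 2)
      (fun j _ => sq_nonneg _) (Finset.mem_univ j)
  have := hsq.sqrt
  simp only [Real.sqrt_sq_eq_abs, Real.sqrt_zero] at this
  exact (tendsto_zero_iff_abs_tendsto_zero _).2 this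
end

section
/- Let E : ℝ → ℝ be differentiable on [0, ∞) with E(t) ≥ 0 for all t ≥ 0, and suppose E′(t) = −g(t) + ξ(t) for all t ≥ 0, where g : ℝ → ℝ is continuous with g(t) ≥ 0, ξ : ℝ → ℝ is continuous with ξ(t) → 0 as t → ∞ and ∫₀^∞ |ξ(t)| dt < ∞, and E′ is uniformly continuous on [0, ∞). Then g(t) → 0 as t → ∞. -/
open MeasureTheory Set Filter

/-- Analytic core of Theorem 1: if `E ≥ 0` is differentiable with
`E′ = −g + ξ`, `g` continuous nonnegative, `ξ` continuous with `ξ(t) → 0` and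
`∫₀^∞ |ξ| < ∞`, and `E′` is uniformly continuous on `[0, ∞)`, then the
dissipation `g(t) → 0` as `t → ∞`. -/
theorem dissipation_tendsto_zero (E g ξ : ℝ → ℝ)
    (hEnonneg : ∀ t : ℝ, 0 ≤ t → 0 ≤ E t)
    (hderiv : ∀ t : ℝ, 0 ≤ t → HasDerivAt E (-g t + ξ t) t)
    (hgcont : ContinuousOn g (Ici 0))
    (hg : ∀ t : ℝ, 0 ≤ t → 0 ≤ g t)
    (hξcont : ContinuousOn ξ (Ici 0))
    (hξlim : Tendsto ξ atTop (nhds 0))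
    (hξint : IntegrableOn (fun t => |ξ t|) (Ici 0))
    (huc : UniformContinuousOn (fun t => -g t + ξ t) (Ici 0)) :
    Tendsto g atTop (nhds 0) := by
  have hξi : IntegrableOn ξ (Ici 0) := by
    have hm : AEStronglyMeasurable ξ (volume.restrict (Ici 0)) :=
      hξcont.aestronglyMeasurable measurableSet_Ici
    exact (integrable_norm_iff hm).1 hξint
  have hii : ∀ t : ℝ, 0 ≤ t → IntervalIntegrable ξ volume 0 t := by
    intro t ht
    rw [intervalIntegrable_iff_integrableOn_Ioc_of_le ht]
    exact hξi.mono_set (fun x hx => hx.1.le)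
  set F : ℝ → ℝ := fun t => E t - ∫ s in (0:ℝ)..t, ξ s with hF
  have hFd : ∀ t : ℝ, 0 < t → HasDerivAt F (-g t) t := by
    intro t ht
    have hc : ContinuousOn ξ (Ioi 0) := hξcont.mono Ioi_subset_Ici_self
    have h1 := intervalIntegral.integral_hasDerivAt_right (hii t ht.le)
      (hc.stronglyMeasurableAtFilter isOpen_Ioi t ht) (hc.continuousAt (Ioi_mem_nhds ht))
    have h2 := (hderiv t ht.le).sub h1
    have h3 : -g t + ξ t - ξ t = -g t := by ring
    rw [h3] at h2
    exact h2
  have hmvt : ∀ a b : ℝ, 0 < a → a < b → ∃ c ∈ Ioo a b, F b - F a = -g c * (b - a) := by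
    intro a b ha hab
    obtain ⟨c, hc, h⟩ := exists_hasDerivAt_eq_slope F (fun t => -g t) hab
      (fun x hx => (hFd x (ha.trans_le hx.1)).continuousAt.continuousWithinAt)
      (fun x hx => hFd x (ha.trans hx.1))
    refine ⟨c, hc, ?_⟩
    have : b - a ≠ 0 := by linarith
    rw [h]; field_simp
  have hanti : ∀ a b : ℝ, 0 < a → a ≤ b → F b ≤ F a := by
    intro a b ha hab
    rcases hab.eq_or_lt with rfl | hab
    · exact le_rfl
    · obtain ⟨c, hc, h⟩ := hmvt a b ha hab
      have := mul_nonneg (hg c (ha.trans hc.1).le) (sub_pos.2 hab).le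
      linarith
  have hbdd : ∀ t : ℝ, 0 ≤ t → -(∫ s in Ici (0:ℝ), |ξ s|) ≤ F t := by
    intro t ht
    have h1 : (∫ s in (0:ℝ)..t, ξ s) ≤ ∫ s in (0:ℝ)..t, |ξ s| :=
      intervalIntegral.integral_mono_on ht (hii t ht) (hii t ht).abs (fun x _ => le_abs_self _)
    have h2 : (∫ s in (0:ℝ)..t, |ξ s|) ≤ ∫ s in Ici (0:ℝ), |ξ s| := by
      rw [intervalIntegral.integral_of_le ht]
      exact setIntegral_mono_set hξint (Eventually.of_forall fun x => abs_nonneg _)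
        (HasSubset.Subset.eventuallyLE (fun x hx => hx.1.le))
    have := hEnonneg t ht
    simp only [hF]
    linarith
  have hlim : ∃ L, Tendsto (fun t => F (max t 1)) atTop (nhds L) := by
    refine ⟨_, tendsto_atTop_ciInf ?_ ⟨-(∫ s in Ici (0:ℝ), |ξ s|), ?_⟩⟩
    · intro a b hab
      exact hanti _ _ (by positivity) (max_le_max_right 1 hab)
    · rintro _ ⟨t, rfl⟩
      exact hbdd _ (by positivity)
  obtain ⟨L, hL⟩ := hlim
  rw [Metric.tendsto_atTop]
  intro ε hε
  obtain ⟨δ, hδ, hu⟩ := Metric.uniformContinuousOn_iff.1 huc (ε / 4) (by positivity)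
  obtain ⟨T1, hT1⟩ := Metric.tendsto_atTop.1 hξlim (ε / 4) (by positivity)
  obtain ⟨T2, hT2⟩ := Metric.tendsto_atTop.1 hL (ε * δ / 16) (by positivity)
  refine ⟨max 1 (max T1 T2), fun t ht => ?_⟩
  have ht1 : 1 ≤ t := (le_max_left _ _).trans ht
  have htT1 : T1 ≤ t := (le_max_left _ _).trans ((le_max_right _ _).trans ht)
  have htT2 : T2 ≤ t := (le_max_right _ _).trans ((le_max_right _ _).trans ht)
  rw [Real.dist_eq, sub_zero, abs_of_nonneg (hg t (by linarith))]
  by_contra! hge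
  obtain ⟨c, ⟨hc1, hc2⟩, hc⟩ := hmvt t (t + δ / 2) (by linarith) (by linarith)
  have a1 := hu c (by simp only [mem_Ici]; linarith) t (by simp only [mem_Ici]; linarith)
    (by rw [Real.dist_eq, abs_lt]; constructor <;> linarith)
  have a2 := hT1 t htT1
  have a3 := hT1 c (by linarith)
  have a4 := hT2 t htT2
  have a5 := hT2 (t + δ / 2) (by linarith)
  simp only [max_eq_left ht1, max_eq_left (by linarith : 1 ≤ t + δ / 2)] at a4 a5
  rw [Real.dist_eq, abs_lt] at a1 a2 a3 a4 a5
  have hgc : ε / 4 ≤ g c := by linarith [a1.2, a2.2, a3.1]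
  have := mul_le_mul_of_nonneg_right hgc (by positivity : 0 ≤ δ / 2)
  have e : t + δ / 2 - t = δ / 2 := by ring
  rw [e] at hc
  linarith [a4.2, a5.1]
end

section
/- Let h : ℝ² → ℝ (Euclidean plane) be continuously differentiable with ‖∇h(x)‖ ≤ c_h for all x, where c_h > 0, let T ≥ 0, and let p : ℝ → ℝ² be continuously differentiable with h(p(t)) > 0 for all t ∈ [0, T]. Then ∫₀^T ‖p′(τ)‖ / h(p(τ)) dτ ≥ (1/c_h) · ln( h(p(0)) / h(p(T)) ). -/
open Set intervalIntegral

/-- Logarithmic lower bound on the Riemannian path length (key inequality in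
the collision-avoidance proof of Theorem 1): for `h : ℝ² → ℝ` continuously
differentiable with `‖∇h‖ ≤ c_h` and a C¹ path `p` on `[0, T]` staying in
`{h > 0}`, `∫₀^T ‖p′(τ)‖ / h(p(τ)) dτ ≥ (1/c_h) ln(h(p(0)) / h(p(T)))`. -/
theorem riemannian_length_log_lower_bound
    (h : EuclideanSpace ℝ (Fin 2) → ℝ) (ch : ℝ) (hch : 0 < ch)
    (hh : ContDiff ℝ 1 h)
    (hgrad : ∀ x : EuclideanSpace ℝ (Fin 2), ‖gradient h x‖ ≤ ch)
    (T : ℝ) (hT : 0 ≤ T)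
    (p p' : ℝ → EuclideanSpace ℝ (Fin 2))
    (hp : ∀ t ∈ Icc (0 : ℝ) T, HasDerivAt p (p' t) t)
    (hp' : ContinuousOn p' (Icc (0 : ℝ) T))
    (hpos : ∀ t ∈ Icc (0 : ℝ) T, 0 < h (p t)) :
    (1 / ch) * Real.log (h (p 0) / h (p T)) ≤
      ∫ τ in (0 : ℝ)..T, ‖p' τ‖ / h (p τ) := by
  have hfd : ∀ x, ‖fderiv ℝ h x‖ ≤ ch := by
    intro x
    have := hgrad x
    rwa [gradient, LinearIsometryEquiv.norm_map] at this
  have hpc : ContinuousOn p (Icc 0 T) := fun t ht => (hp t ht).continuousAt.continuousWithinAt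
  have hhp : ContinuousOn (fun t => h (p t)) (Icc 0 T) := hh.continuous.comp_continuousOn hpc
  have hne : ∀ t ∈ Icc (0 : ℝ) T, h (p t) ≠ 0 := fun t ht => (hpos t ht).ne'
  have hD : ∀ t ∈ Icc (0 : ℝ) T, HasDerivAt (fun t => -(1 / ch) * Real.log (h (p t)))
      (-(1 / ch) * (fderiv ℝ h (p t) (p' t) / h (p t))) t := by
    intro t ht
    have h1 : HasFDerivAt h (fderiv ℝ h (p t)) (p t) :=
      ((hh.differentiable (by norm_num)) (p t)).hasFDerivAt
    exact ((h1.comp_hasDerivAt t (hp t ht)).log (hne t ht)).const_mul _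
  have hfc : ContinuousOn (fun t => fderiv ℝ h (p t) (p' t)) (Icc 0 T) :=
    ((hh.continuous_fderiv (by norm_num)).comp_continuousOn hpc).clm_apply hp'
  have hc1 : ContinuousOn (fun t => -(1 / ch) * (fderiv ℝ h (p t) (p' t) / h (p t))) (Icc 0 T) :=
    continuousOn_const.mul (hfc.div hhp hne)
  have hc2 : ContinuousOn (fun t => ‖p' t‖ / h (p t)) (Icc 0 T) := hp'.norm.div hhp hne
  have hi1 := hc1.intervalIntegrable_of_Icc (μ := MeasureTheory.volume) hT
  have hi2 := hc2.intervalIntegrable_of_Icc (μ := MeasureTheory.volume) hT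
  have hF := integral_eq_sub_of_hasDerivAt (fun t ht => hD t (by rwa [uIcc_of_le hT] at ht)) hi1
  have hle := integral_mono_on hT hi1 hi2 (by
    intro t ht
    have hq := hpos t ht
    have h2 : -(fderiv ℝ h (p t) (p' t)) ≤ ch * ‖p' t‖ :=
      (neg_le_abs _).trans (((fderiv ℝ h (p t)).le_opNorm (p' t)).trans
        (mul_le_mul_of_nonneg_right (hfd _) (norm_nonneg _)))
    have h3 : -(1 / ch) * (fderiv ℝ h (p t) (p' t) / h (p t))
        = (-(fderiv ℝ h (p t) (p' t)) / ch) / h (p t) := by ring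
    rw [h3]
    apply div_le_div_of_nonneg_right _ hq.le
    rw [div_le_iff₀ hch]
    linarith)
  rw [Real.log_div (hne 0 ⟨le_rfl, hT⟩) (hne T ⟨hT, le_rfl⟩)]
  rw [hF] at hle
  linarith
end

section
/- Let h : ℝ² → ℝ (Euclidean plane) be continuously differentiable with ‖∇h(x)‖ ≤ c_h for all x, where c_h > 0, let t_c > 0, and let p : ℝ → ℝ² be continuously differentiable with h(p(t)) > 0 for all t ∈ [0, t_c) and h(p(t_c)) = 0. Then the g-length of the path up to time s, L(s) = ∫₀^s ‖p′(τ)‖ / h(p(τ)) dτ, tends to +∞ as s → t_c from the left. -/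
open Set Filter intervalIntegral

/-- Collision-avoidance claim of Theorem 1: any C¹ trajectory that stays in
`{h > 0}` on `[0, t_c)` and reaches the boundary `{h = 0}` at time `t_c` has
Riemannian g-length `L(s) = ∫₀^s ‖p′(τ)‖ / h(p(τ)) dτ` tending to `+∞` as
`s → t_c⁻` (here `‖∇h‖ ≤ c_h`). -/
theorem riemannian_length_blowup_at_boundary
    (h : EuclideanSpace ℝ (Fin 2) → ℝ) (ch : ℝ) (hch : 0 < ch)
    (hh : ContDiff ℝ 1 h)
    (hgrad : ∀ x : EuclideanSpace ℝ (Fin 2), ‖gradient h x‖ ≤ ch)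
    (tc : ℝ) (htc : 0 < tc)
    (p p' : ℝ → EuclideanSpace ℝ (Fin 2))
    (hp : ∀ t ∈ Icc (0 : ℝ) tc, HasDerivAt p (p' t) t)
    (hp' : ContinuousOn p' (Icc (0 : ℝ) tc))
    (hpos : ∀ t ∈ Ico (0 : ℝ) tc, 0 < h (p t))
    (hboundary : h (p tc) = 0) :
    Tendsto (fun s => ∫ τ in (0 : ℝ)..s, ‖p' τ‖ / h (p τ))
      (nhdsWithin tc (Iio tc)) atTop := by
  have hpc : ContinuousOn p (Icc (0 : ℝ) tc) := fun t ht => (hp t ht).continuousAt.continuousWithinAt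
  have hfd : Continuous (fderiv ℝ h) := hh.continuous_fderiv (by norm_num)
  have hdiff : Differentiable ℝ h := hh.differentiable (by norm_num)
  have hbound : ∀ x, ‖fderiv ℝ h x‖ ≤ ch := by
    intro x
    have h1 := hgrad x
    unfold gradient at h1
    rwa [LinearIsometryEquiv.norm_map] at h1
  have key : ∀ s ∈ Ioo (0 : ℝ) tc,
      (Real.log (h (p 0)) - Real.log (h (p s))) / ch ≤ ∫ τ in (0 : ℝ)..s, ‖p' τ‖ / h (p τ) := by
    intro s hs
    have hsub : uIcc (0 : ℝ) s ⊆ Icc 0 tc := by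
      rw [uIcc_of_le hs.1.le]
      exact Icc_subset_Icc_right hs.2.le
    have hpos' : ∀ t ∈ uIcc (0 : ℝ) s, 0 < h (p t) := by
      intro t ht
      rw [uIcc_of_le hs.1.le] at ht
      exact hpos t ⟨ht.1, lt_of_le_of_lt ht.2 hs.2⟩
    have hpc' := hpc.mono hsub
    have hp'c := hp'.mono hsub
    have hhc : ContinuousOn (fun τ => h (p τ)) (uIcc (0 : ℝ) s) :=
      hh.continuous.comp_continuousOn hpc'
    have hD : ContinuousOn (fun τ => fderiv ℝ h (p τ) (p' τ) / h (p τ)) (uIcc (0 : ℝ) s) :=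
      ((hfd.comp_continuousOn hpc').clm_apply hp'c).div hhc (fun t ht => (hpos' t ht).ne')
    have hN : ContinuousOn (fun τ => ‖p' τ‖ / h (p τ)) (uIcc (0 : ℝ) s) :=
      hp'c.norm.div hhc (fun t ht => (hpos' t ht).ne')
    have hftc : ∫ τ in (0 : ℝ)..s, fderiv ℝ h (p τ) (p' τ) / h (p τ)
        = Real.log (h (p s)) - Real.log (h (p 0)) := by
      refine integral_eq_sub_of_hasDerivAt (f := fun τ => Real.log (h (p τ))) ?_ hD.intervalIntegrable
      intro t ht
      exact ((hdiff (p t)).hasFDerivAt.comp_hasDerivAt t (hp t (hsub ht))).log (hpos' t ht).ne'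
    have hmono : ∫ τ in (0 : ℝ)..s, -(fderiv ℝ h (p τ) (p' τ) / h (p τ))
        ≤ ∫ τ in (0 : ℝ)..s, ch * (‖p' τ‖ / h (p τ)) := by
      refine integral_mono_on hs.1.le hD.intervalIntegrable.neg
        (hN.intervalIntegrable.const_mul ch) ?_
      intro t ht
      have hpt := hpos' t (by rwa [uIcc_of_le hs.1.le])
      have h1 : -(fderiv ℝ h (p t) (p' t)) ≤ ch * ‖p' t‖ :=
        (neg_le_abs _).trans (((fderiv ℝ h (p t)).le_opNorm (p' t)).trans
          (mul_le_mul_of_nonneg_right (hbound _) (norm_nonneg _)))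
      rw [← neg_div, ← mul_div_assoc]
      exact div_le_div_of_nonneg_right h1 hpt.le
    rw [intervalIntegral.integral_neg, hftc, intervalIntegral.integral_const_mul] at hmono
    rw [div_le_iff₀ hch]
    linarith
  have hev : ∀ᶠ s in nhdsWithin tc (Iio tc), s ∈ Ioo (0 : ℝ) tc :=
    Ioo_mem_nhdsLT htc
  refine tendsto_atTop_mono' _ (hev.mono key) ?_
  have hlim : Tendsto (fun s => h (p s)) (nhdsWithin tc (Iio tc)) (nhdsWithin 0 (Ioi 0)) := by
    refine tendsto_nhdsWithin_iff.2 ⟨?_, hev.mono fun s hs => hpos s ⟨hs.1.le, hs.2⟩⟩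
    have hc : ContinuousAt (fun s => h (p s)) tc :=
      hh.continuous.continuousAt.comp (hp tc ⟨htc.le, le_rfl⟩).continuousAt
    have h2 := hc.tendsto
    simp only [hboundary] at h2
    exact h2.mono_left nhdsWithin_le_nhds
  have hlog := Real.tendsto_log_nhdsGT_zero.comp hlim
  refine Tendsto.atTop_div_const hch ?_
  exact tendsto_atTop_add_const_left _ _ (tendsto_neg_atBot_atTop.comp hlog)
end

section
/- Let h : ℝ² → ℝ (Euclidean plane) be continuously differentiable with ‖∇h(x)‖ ≤ c_h for all x, where c_h > 0, let v > 0, and let p : ℝ → ℝ² be continuously differentiable on [0, ∞) with h(p(0)) > 0. Suppose that for every t ≥ 0 with h(p(t)) > 0 one has ‖p′(t)‖ ≤ v · h(p(t)) (bounded Riemannian speed). Then for all t ≥ 0, h(p(t)) ≥ h(p(0)) · e^{−c_h v t} > 0; in particular the trajectory never reaches the boundary {h = 0}. -/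
open Set

/-- Quantitative safety bound (collision-avoidance conclusion of Theorem 1):
if `‖∇h‖ ≤ c_h`, `h(p(0)) > 0`, and the trajectory has bounded Riemannian
speed `‖p′(t)‖ ≤ v · h(p(t))` whenever `h(p(t)) > 0`, then for all `t ≥ 0`,
`h(p(t)) ≥ h(p(0)) e^{−c_h v t} > 0`: the trajectory never reaches `{h = 0}`. -/
theorem trajectory_never_reaches_boundary
    (h : EuclideanSpace ℝ (Fin 2) → ℝ) (ch v : ℝ) (hch : 0 < ch) (hv : 0 < v)
    (hh : ContDiff ℝ 1 h)
    (hgrad : ∀ x : EuclideanSpace ℝ (Fin 2), ‖gradient h x‖ ≤ ch)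
    (p p' : ℝ → EuclideanSpace ℝ (Fin 2))
    (hp : ∀ t : ℝ, 0 ≤ t → HasDerivAt p (p' t) t)
    (hp' : ContinuousOn p' (Ici 0))
    (h0 : 0 < h (p 0))
    (hspeed : ∀ t : ℝ, 0 ≤ t → 0 < h (p t) → ‖p' t‖ ≤ v * h (p t)) :
    ∀ t : ℝ, 0 ≤ t →
      h (p 0) * Real.exp (-(ch * v) * t) ≤ h (p t) ∧ 0 < h (p t) := by
  have hd : ∀ t : ℝ, 0 ≤ t → HasDerivAt (fun s => h (p s)) (fderiv ℝ h (p t) (p' t)) t := by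
    intro t ht
    have h1 : HasFDerivAt h (fderiv ℝ h (p t)) (p t) :=
      ((hh.differentiable (by norm_num)) (p t)).hasFDerivAt
    exact h1.comp_hasDerivAt t (hp t ht)
  have hlow : ∀ t : ℝ, 0 ≤ t → 0 < h (p t) →
      -(ch * v) * h (p t) ≤ fderiv ℝ h (p t) (p' t) := by
    intro t ht hpos
    have hn : ‖fderiv ℝ h (p t)‖ ≤ ch := by
      have := hgrad (p t)
      rwa [gradient, LinearIsometryEquiv.norm_map] at this
    have h1 : ‖fderiv ℝ h (p t) (p' t)‖ ≤ ch * (v * h (p t)) :=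
      (ContinuousLinearMap.le_opNorm _ _).trans
        (mul_le_mul hn (hspeed t ht hpos) (norm_nonneg _) hch.le)
    have h2 := neg_le_of_abs_le h1
    linarith
  have key : ∀ k : ℝ, ch * v < k → ∀ t : ℝ, 0 ≤ t →
      h (p 0) * Real.exp (-k * t) ≤ h (p t) := by
    intro k hk t ht
    have hf : ∀ x : ℝ, HasDerivAt (fun s => h (p 0) * Real.exp (-k * s))
        (h (p 0) * (Real.exp (-k * x) * (-k))) x := by
      intro x
      have h1 : HasDerivAt (fun s : ℝ => -k * s) (-k) x := by
        simpa using (hasDerivAt_id x).const_mul (-k)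
      exact h1.exp.const_mul _
    refine image_le_of_deriv_right_lt_deriv_boundary' (a := 0) (b := t)
      (f := fun s => h (p 0) * Real.exp (-k * s))
      (f' := fun x => h (p 0) * (Real.exp (-k * x) * (-k)))
      (B := fun s => h (p s)) (B' := fun s => fderiv ℝ h (p s) (p' s))
      (fun x _ => (hf x).continuousAt.continuousWithinAt)
      (fun x _ => (hf x).hasDerivWithinAt) (by simp)
      (fun x hx => (hd x hx.1).continuousAt.continuousWithinAt)
      (fun x hx => (hd x hx.1).hasDerivWithinAt) ?_ (right_mem_Icc.2 ht)
    intro x hx hxe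
    have hxe' : h (p 0) * Real.exp (-k * x) = h (p x) := hxe
    have hpos : 0 < h (p x) := hxe' ▸ mul_pos h0 (Real.exp_pos _)
    have h1 := hlow x hx.1 hpos
    have h2 : h (p 0) * (Real.exp (-k * x) * (-k)) = -k * h (p x) := by
      rw [← hxe']; ring
    show h (p 0) * (Real.exp (-k * x) * (-k)) < _
    rw [h2]
    nlinarith
  intro t ht
  have main : h (p 0) * Real.exp (-(ch * v) * t) ≤ h (p t) := by
    have hc : Continuous fun k : ℝ => h (p 0) * Real.exp (-k * t) := by fun_prop
    refine le_of_tendsto (x := nhdsWithin (ch * v) (Ioi (ch * v)))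
      (hc.continuousAt.continuousWithinAt (s := Ioi (ch * v)) (x := ch * v)) ?_
    filter_upwards [self_mem_nhdsWithin] with k hk
    exact key k hk t ht
  exact ⟨main, lt_of_lt_of_le (mul_pos h0 (Real.exp_pos _)) main⟩
end
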